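/- arXiv:1401.2565 — 2 statements merged into one kernel-verified Lean document; each statement's English description precedes it below -/
import Mathlib

section
/- Let n ≥ 4 be an integer and a, b real numbers with 1 + a² < b². Let L : ℝⁿ → ℝ^{n+2} be immersion (C): with S = sinh x_{n−2}, C = cosh x_{n−2}, P = ∏_{j=1}^{n−3} cosh x_j, the coordinates are (u₁, u₂, u₃) = (aS+bC)P·(cosh x_{n−1} cosh x_n, cosh x_{n−1} sinh x_n, sinh x_{n−1}); u_{k+3} = sinh(x_k)∏_{j=1}^{k−1} cosh x_j for 1 ≤ k ≤ n−3; u_{n+1} = (√(b²−a²−1)/√(1+a²)) C P; u_{n+2} = (abC + (1+a²)S)P/√(1+a²). Then for every x ∈ ℝⁿ: η(∂L/∂x_i(x), ∂L/∂x_j(x)) = 0 for i ≠ j; η(∂L/∂x₁, ∂L/∂x₁) = 1; η(∂L/∂x_k, ∂L/∂x_k) = ∏_{j=1}^{k−1} cosh²x_j for 2 ≤ k ≤ n−2; η(∂L/∂x_{n−1}, ∂L/∂x_{n−1}) = (aS+bC)² P²; and η(∂L/∂x_n, ∂L/∂x_n) = (aS+bC)² P² cosh²x_{n−1}. In particular L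 induces the warped-product metric dx₁² + cosh²x₁ dx₂² + ⋯ + (∏_{j=1}^{n−3} cosh²x_j) dx_{n−2}² + (a sinh x_{n−2} + b cosh x_{n−2})²(∏_{j=1}^{n−3} cosh²x_j)(dx_{n−1}² + cosh²x_{n−1} dx_n²) wherever this form is positive definite. -/
open Real

/-- The Minkowski (Lorentzian) bilinear form `η(u,v) = -u₁v₁ + Σ_{j≥2} uⱼvⱼ` on `ℝ^{N+1}`. -/
noncomputable def eta {N : ℕ} (u v : EuclideanSpace ℝ (Fin (N + 1))) : ℝ :=
  -(u 0 * v 0) + ∑ j : Fin N, u j.succ * v j.succ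

/-- Partial derivative of `L` at `x` in the direction of the `i`-th standard basis vector,
in the sense of the Fréchet derivative. -/
noncomputable def pd {n : ℕ} {F : Type*} [NormedAddCommGroup F] [NormedSpace ℝ F]
    (L : EuclideanSpace ℝ (Fin n) → F) (x : EuclideanSpace ℝ (Fin n)) (i : Fin n) : F :=
  fderiv ℝ L x (EuclideanSpace.single i 1)

/-- The coordinates of `x`, extended by zero to a sequence. -/
noncomputable def coordSeq {n : ℕ} (x : EuclideanSpace ℝ (Fin n)) (k : ℕ) : ℝ :=
  if h : k < n then x ⟨k, h⟩ else 0

theorem coordSeq_of_lt {n k : ℕ} (x : EuclideanSpace ℝ (Fin n)) (h : k < n) :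
    coordSeq x k = x ⟨k, h⟩ := dif_pos h

theorem coordSeq_add_smul {n : ℕ} (x e : EuclideanSpace ℝ (Fin n)) (t : ℝ) (k : ℕ) :
    coordSeq (x + t • e) k = coordSeq x k + t * coordSeq e k := by
  unfold coordSeq
  split_ifs <;> simp

theorem coordSeq_single {n : ℕ} (i : Fin n) (k : ℕ) :
    coordSeq (EuclideanSpace.single i (1 : ℝ)) k = if k = i then 1 else 0 := by
  unfold coordSeq
  split_ifs with h h' h' <;> simp_all [Fin.ext_iff]

/-- The partial products `cosh X₀ ⋯ cosh X_{r-1}`. -/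
noncomputable def coshProd (X : ℕ → ℝ) (r : ℕ) : ℝ := ∏ j ∈ Finset.range r, Real.cosh (X j)

/-- The directional derivative of `coshProd · r` at `X` along `v`. -/
noncomputable def coshProdDeriv (X v : ℕ → ℝ) : ℕ → ℝ
  | 0 => 0
  | r + 1 => coshProdDeriv X v r * Real.cosh (X r) + coshProd X r * (Real.sinh (X r) * v r)

theorem coshProd_succ (X : ℕ → ℝ) (r : ℕ) :
    coshProd X (r + 1) = coshProd X r * Real.cosh (X r) := Finset.prod_range_succ _ _

theorem prod_castLE_cosh {n r : ℕ} (x : EuclideanSpace ℝ (Fin n)) (h : r ≤ n) :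
    ∏ j : Fin r, Real.cosh (x (Fin.castLE h j)) = coshProd (coordSeq x) r := by
  rw [coshProd, Finset.prod_range]
  refine Finset.prod_congr rfl fun j _ => ?_
  rw [coordSeq_of_lt x (j.isLt.trans_le h)]
  rfl

theorem hasDerivAt_add_mul (c d : ℝ) : HasDerivAt (fun t : ℝ => c + t * d) d 0 := by
  simpa using ((hasDerivAt_id (0 : ℝ)).mul_const d).const_add c

theorem hasDerivAt_cosh_add_mul (c d : ℝ) :
    HasDerivAt (fun t : ℝ => Real.cosh (c + t * d)) (Real.sinh c * d) 0 := by
  simpa using (hasDerivAt_add_mul c d).cosh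

theorem hasDerivAt_sinh_add_mul (c d : ℝ) :
    HasDerivAt (fun t : ℝ => Real.sinh (c + t * d)) (Real.cosh c * d) 0 := by
  simpa using (hasDerivAt_add_mul c d).sinh

theorem hasDerivAt_coshProd (X v : ℕ → ℝ) (r : ℕ) :
    HasDerivAt (fun t : ℝ => coshProd (fun k => X k + t * v k) r) (coshProdDeriv X v r) 0 := by
  induction r with
  | zero => simpa [coshProd, coshProdDeriv] using hasDerivAt_const (0 : ℝ) (1 : ℝ)
  | succ r ih =>
    simp only [coshProd_succ, coshProdDeriv]
    simpa using! ih.mul (hasDerivAt_cosh_add_mul (X r) (v r))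

/-- The squared lengths of the derivatives of the spherical-type hyperbolic coordinates
`sinh X_k ∏_{j<k} cosh X_j`, polarized. -/
theorem sum_deriv_sinh_mul_coshProd (X v w : ℕ → ℝ) (r : ℕ) :
    ∑ k ∈ Finset.range r,
        (Real.cosh (X k) * v k * coshProd X k + Real.sinh (X k) * coshProdDeriv X v k) *
        (Real.cosh (X k) * w k * coshProd X k + Real.sinh (X k) * coshProdDeriv X w k) =
      coshProdDeriv X v r * coshProdDeriv X w r +
        ∑ k ∈ Finset.range r, coshProd X k ^ 2 * (v k * w k) := by
  induction r with
  | zero => simp [coshProdDeriv]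
  | succ r ih =>
    rw [Finset.sum_range_succ, Finset.sum_range_succ, ih]
    simp only [coshProdDeriv]
    linear_combination
      (coshProd X r ^ 2 * (v r * w r) - coshProdDeriv X v r * coshProdDeriv X w r) *
        Real.cosh_sq_sub_sinh_sq (X r)

theorem eta_eq_add_sum {m : ℕ} (u v : EuclideanSpace ℝ (Fin (m + 5))) :
    eta u v = -(u ⟨0, by omega⟩ * v ⟨0, by omega⟩) + u ⟨1, by omega⟩ * v ⟨1, by omega⟩ +
      u ⟨2, by omega⟩ * v ⟨2, by omega⟩ +
      ∑ k : Fin m, u ⟨k + 3, by omega⟩ * v ⟨k + 3, by omega⟩ +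
      u ⟨m + 3, by omega⟩ * v ⟨m + 3, by omega⟩ +
      u ⟨m + 4, by omega⟩ * v ⟨m + 4, by omega⟩ := by
  rw [eta, Fin.sum_univ_succ, Fin.sum_univ_succ, Fin.sum_univ_castSucc, Fin.sum_univ_castSucc]
  simp only [← add_assoc]
  rfl

/-- If a coordinate of `L` is known along the line `t ↦ x + t • e`, it determines the same
coordinate of the directional derivative. -/
theorem fderiv_apply_coord {n p : ℕ} {L : EuclideanSpace ℝ (Fin n) → EuclideanSpace ℝ (Fin p)}
    {x e : EuclideanSpace ℝ (Fin n)} {k : Fin p} {d : ℝ} (hL : DifferentiableAt ℝ L x)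
    (h : HasDerivAt (fun t : ℝ => L (x + t • e) k) d 0) : fderiv ℝ L x e k = d := by
  have h1 : HasDerivAt (fun t : ℝ => L (x + t • e)) (fderiv ℝ L x e) 0 :=
    hL.hasFDerivAt.hasLineDerivAt e
  have h2 := ((EuclideanSpace.proj (𝕜 := ℝ) k).hasFDerivAt).comp_hasDerivAt (0 : ℝ) h1
  exact h2.unique h

theorem lorentz_hyperbolic_plane_part {g d d' y₁ y₂ z₁ z₂ v₁ v₂ w₁ w₂ : ℝ}
    (hy : y₁ ^ 2 - y₂ ^ 2 = 1) (hz : z₁ ^ 2 - z₂ ^ 2 = 1) :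
    -((d * y₁ * z₁ + g * (y₂ * v₁) * z₁ + g * y₁ * (z₂ * v₂)) *
        (d' * y₁ * z₁ + g * (y₂ * w₁) * z₁ + g * y₁ * (z₂ * w₂))) +
      (d * y₁ * z₂ + g * (y₂ * v₁) * z₂ + g * y₁ * (z₁ * v₂)) *
        (d' * y₁ * z₂ + g * (y₂ * w₁) * z₂ + g * y₁ * (z₁ * w₂)) +
      (d * y₂ + g * (y₁ * v₁)) * (d' * y₂ + g * (y₁ * w₁)) =
    -(d * d') + g ^ 2 * (v₁ * w₁ + y₁ ^ 2 * (v₂ * w₂)) := by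
  linear_combination
    (-(d * y₁ + g * y₂ * v₁) * (d' * y₁ + g * y₂ * w₁) + g * y₁ * v₂ * (g * y₁ * w₂)) * hz +
      (-(d * d') + g ^ 2 * (v₁ * w₁)) * hy

theorem lorentz_radial_part {a b A B C S P p q v w : ℝ}
    (hA : A ^ 2 = (b ^ 2 - a ^ 2 - 1) * B ^ 2) (hB : B ^ 2 * (1 + a ^ 2) = 1)
    (hC : C ^ 2 - S ^ 2 = 1) :
    -(((a * C + b * S) * v * P + (a * S + b * C) * p) *
        ((a * C + b * S) * w * P + (a * S + b * C) * q)) + p * q +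
      A * (S * v * P + C * p) * (A * (S * w * P + C * q)) +
      B * ((a * b * S + (1 + a ^ 2) * C) * v * P + (a * b * C + (1 + a ^ 2) * S) * p) *
        (B * ((a * b * S + (1 + a ^ 2) * C) * w * P + (a * b * C + (1 + a ^ 2) * S) * q)) =
    P ^ 2 * (v * w) := by
  linear_combination
    (p * C + P * S * v) * (q * C + P * S * w) * hA +
      ((b ^ 2 - 1) * ((p * C + P * S * v) * (q * C + P * S * w)) +
        a * b * ((p * C + P * S * v) * (q * S + P * C * w) +
          (q * C + P * S * w) * (p * S + P * C * v)) +
        (1 + a ^ 2) * ((p * S + P * C * v) * (q * S + P * C * w))) * hB +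
      (-(p * q) + P ^ 2 * (v * w)) * hC

/-- The metric induced by the immersion, evaluated on two arbitrary tangent vectors. -/
theorem eta_fderiv_eq {m : ℕ} {a b A B : ℝ}
    (hA : A ^ 2 = (b ^ 2 - a ^ 2 - 1) * B ^ 2) (hB : B ^ 2 * (1 + a ^ 2) = 1)
    {L : EuclideanSpace ℝ (Fin (m + 3)) → EuclideanSpace ℝ (Fin (m + 5))}
    (hL : Differentiable ℝ L)
    (h0 : ∀ x, L x ⟨0, by omega⟩ =
      (a * Real.sinh (coordSeq x m) + b * Real.cosh (coordSeq x m)) * coshProd (coordSeq x) m *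
        Real.cosh (coordSeq x (m + 1)) * Real.cosh (coordSeq x (m + 2)))
    (h1 : ∀ x, L x ⟨1, by omega⟩ =
      (a * Real.sinh (coordSeq x m) + b * Real.cosh (coordSeq x m)) * coshProd (coordSeq x) m *
        Real.cosh (coordSeq x (m + 1)) * Real.sinh (coordSeq x (m + 2)))
    (h2 : ∀ x, L x ⟨2, by omega⟩ =
      (a * Real.sinh (coordSeq x m) + b * Real.cosh (coordSeq x m)) * coshProd (coordSeq x) m *
        Real.sinh (coordSeq x (m + 1)))
    (h3 : ∀ x, ∀ k : Fin m, L x ⟨k + 3, by omega⟩ =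
      Real.sinh (coordSeq x k) * coshProd (coordSeq x) k)
    (h4 : ∀ x, L x ⟨m + 3, by omega⟩ =
      A * (Real.cosh (coordSeq x m) * coshProd (coordSeq x) m))
    (h5 : ∀ x, L x ⟨m + 4, by omega⟩ =
      B * ((a * b * Real.cosh (coordSeq x m) + (1 + a ^ 2) * Real.sinh (coordSeq x m)) *
        coshProd (coordSeq x) m))
    (x e e' : EuclideanSpace ℝ (Fin (m + 3))) :
    eta (fderiv ℝ L x e) (fderiv ℝ L x e') =
      ∑ k ∈ Finset.range m, coshProd (coordSeq x) k ^ 2 * (coordSeq e k * coordSeq e' k) +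
        coshProd (coordSeq x) m ^ 2 * (coordSeq e m * coordSeq e' m) +
        ((a * Real.sinh (coordSeq x m) + b * Real.cosh (coordSeq x m)) *
            coshProd (coordSeq x) m) ^ 2 *
          (coordSeq e (m + 1) * coordSeq e' (m + 1) +
            Real.cosh (coordSeq x (m + 1)) ^ 2 * (coordSeq e (m + 2) * coordSeq e' (m + 2))) := by
  set X := coordSeq x with hX
  have hX' : ∀ (e : EuclideanSpace ℝ (Fin (m + 3))) (t : ℝ),
      coordSeq (x + t • e) = fun k => X k + t * coordSeq e k :=
    fun e t => funext fun k => coordSeq_add_smul x e t k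
  have hs := fun (e : EuclideanSpace ℝ (Fin (m + 3))) k =>
    hasDerivAt_sinh_add_mul (X k) (coordSeq e k)
  have hc := fun (e : EuclideanSpace ℝ (Fin (m + 3))) k =>
    hasDerivAt_cosh_add_mul (X k) (coordSeq e k)
  have hP := fun (e : EuclideanSpace ℝ (Fin (m + 3))) r => hasDerivAt_coshProd X (coordSeq e) r
  have hg : ∀ e : EuclideanSpace ℝ (Fin (m + 3)), HasDerivAt
      (fun t : ℝ => (a * Real.sinh (X m + t * coordSeq e m) +
        b * Real.cosh (X m + t * coordSeq e m)) * coshProd (fun k => X k + t * coordSeq e k) m)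
      ((a * Real.cosh (X m) + b * Real.sinh (X m)) * coordSeq e m * coshProd X m +
        (a * Real.sinh (X m) + b * Real.cosh (X m)) * coshProdDeriv X (coordSeq e) m) 0 := by
    intro e
    convert! (((hs e m).const_mul a).add ((hc e m).const_mul b)).mul (hP e m) using 1
    simp only [Pi.add_apply, zero_mul, add_zero]
    ring
  have d0 := fun e => fderiv_apply_coord (e := e) (k := ⟨0, by omega⟩) (hL x) (by
    simp only [h0, hX']
    exact ((hg e).mul (hc e (m + 1))).mul (hc e (m + 2)))
  have d1 := fun e => fderiv_apply_coord (e := e) (k := ⟨1, by omega⟩) (hL x) (by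
    simp only [h1, hX']
    exact ((hg e).mul (hc e (m + 1))).mul (hs e (m + 2)))
  have d2 := fun e => fderiv_apply_coord (e := e) (k := ⟨2, by omega⟩) (hL x) (by
    simp only [h2, hX']
    exact (hg e).mul (hs e (m + 1)))
  have d3 := fun e (k : Fin m) => fderiv_apply_coord (e := e) (k := ⟨k + 3, by omega⟩) (hL x) (by
    simp only [h3, hX']
    exact (hs e k).mul (hP e k))
  have d4 := fun e => fderiv_apply_coord (e := e) (k := ⟨m + 3, by omega⟩) (hL x) (by
    simp only [h4, hX']
    exact ((hc e m).mul (hP e m)).const_mul A)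
  have d5 := fun e => fderiv_apply_coord (e := e) (k := ⟨m + 4, by omega⟩) (hL x) (by
    simp only [h5, hX']
    exact ((((hc e m).const_mul (a * b)).add ((hs e m).const_mul (1 + a ^ 2))).mul
      (hP e m)).const_mul B)
  rw [eta_eq_add_sum]
  simp only [d0, d1, d2, d3, d4, d5]
  simp only [Pi.mul_apply, Pi.add_apply, zero_mul, add_zero]
  have hsum := sum_deriv_sinh_mul_coshProd X (coordSeq e) (coordSeq e') m
  rw [Finset.sum_range] at hsum
  rw [hsum]
  have t1 := lorentz_hyperbolic_plane_part
    (g := (a * Real.sinh (X m) + b * Real.cosh (X m)) * coshProd X m)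
    (d := (a * Real.cosh (X m) + b * Real.sinh (X m)) * coordSeq e m * coshProd X m +
        (a * Real.sinh (X m) + b * Real.cosh (X m)) * coshProdDeriv X (coordSeq e) m)
    (d' := (a * Real.cosh (X m) + b * Real.sinh (X m)) * coordSeq e' m * coshProd X m +
        (a * Real.sinh (X m) + b * Real.cosh (X m)) * coshProdDeriv X (coordSeq e') m)
    (v₁ := coordSeq e (m + 1)) (v₂ := coordSeq e (m + 2))
    (w₁ := coordSeq e' (m + 1)) (w₂ := coordSeq e' (m + 2))
    (Real.cosh_sq_sub_sinh_sq (X (m + 1))) (Real.cosh_sq_sub_sinh_sq (X (m + 2)))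
  have t2 := lorentz_radial_part (P := coshProd X m) (p := coshProdDeriv X (coordSeq e) m)
    (q := coshProdDeriv X (coordSeq e') m) (v := coordSeq e m) (w := coordSeq e' m)
    hA hB (Real.cosh_sq_sub_sinh_sq (X m))
  linear_combination t1 + t2

theorem stmt12 (n : ℕ) (hn : 4 ≤ n) (a b : ℝ) (hab : 1 + a ^ 2 < b ^ 2)
    (L : EuclideanSpace ℝ (Fin n) → EuclideanSpace ℝ (Fin (n + 2)))
    (hL : ∀ (x : EuclideanSpace ℝ (Fin n)) (k : Fin (n + 2)),
      L x k =
        (let S := Real.sinh (x ⟨n - 3, by omega⟩);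
         let C := Real.cosh (x ⟨n - 3, by omega⟩);
         let P := ∏ j : Fin (n - 3), Real.cosh (x (Fin.castLE (by omega) j));
         if (k : ℕ) = 0 then
           (a * S + b * C) * Real.cosh (x ⟨n - 2, by omega⟩) *
             Real.cosh (x ⟨n - 1, by omega⟩) * P
         else if (k : ℕ) = 1 then
           (a * S + b * C) * Real.cosh (x ⟨n - 2, by omega⟩) *
             Real.sinh (x ⟨n - 1, by omega⟩) * P
         else if (k : ℕ) = 2 then
           (a * S + b * C) * Real.sinh (x ⟨n - 2, by omega⟩) * P
         else if h : (k : ℕ) ≤ n - 1 then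
           Real.sinh (x ⟨(k : ℕ) - 3, by omega⟩) *
             ∏ j : Fin ((k : ℕ) - 3), Real.cosh (x (Fin.castLE (by omega) j))
         else if (k : ℕ) = n then
           Real.sqrt (b ^ 2 - a ^ 2 - 1) / Real.sqrt (1 + a ^ 2) * C * P
         else
           (a * b * C + (1 + a ^ 2) * S) * P / Real.sqrt (1 + a ^ 2))) :
    ∀ x : EuclideanSpace ℝ (Fin n),
      (∀ i j : Fin n, i ≠ j → eta (pd L x i) (pd L x j) = 0) ∧
      eta (pd L x ⟨0, by omega⟩) (pd L x ⟨0, by omega⟩) = 1 ∧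
      (∀ i : Fin n, 1 ≤ (i : ℕ) → (i : ℕ) ≤ n - 3 →
        eta (pd L x i) (pd L x i) =
          ∏ j : Fin (i : ℕ), Real.cosh (x (Fin.castLE i.isLt.le j)) ^ 2) ∧
      eta (pd L x ⟨n - 2, by omega⟩) (pd L x ⟨n - 2, by omega⟩) =
        (a * Real.sinh (x ⟨n - 3, by omega⟩) + b * Real.cosh (x ⟨n - 3, by omega⟩)) ^ 2 *
          (∏ j : Fin (n - 3), Real.cosh (x (Fin.castLE (by omega) j))) ^ 2 ∧
      eta (pd L x ⟨n - 1, by omega⟩) (pd L x ⟨n - 1, by omega⟩) =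
        (a * Real.sinh (x ⟨n - 3, by omega⟩) + b * Real.cosh (x ⟨n - 3, by omega⟩)) ^ 2 *
          (∏ j : Fin (n - 3), Real.cosh (x (Fin.castLE (by omega) j))) ^ 2 *
          Real.cosh (x ⟨n - 2, by omega⟩) ^ 2 := by
  obtain ⟨m, rfl⟩ : ∃ m, n = m + 3 := ⟨n - 3, by omega⟩
  have hs : 0 < 1 + a ^ 2 := by positivity
  have hA : (Real.sqrt (b ^ 2 - a ^ 2 - 1) / Real.sqrt (1 + a ^ 2)) ^ 2 =
      (b ^ 2 - a ^ 2 - 1) * (Real.sqrt (1 + a ^ 2))⁻¹ ^ 2 := by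
    rw [div_pow, Real.sq_sqrt (by linarith), inv_pow, div_eq_mul_inv]
  have hB : (Real.sqrt (1 + a ^ 2))⁻¹ ^ 2 * (1 + a ^ 2) = 1 := by
    rw [inv_pow, Real.sq_sqrt hs.le, inv_mul_cancel₀ hs.ne']
  have hdiff : Differentiable ℝ L := by
    rw [differentiable_euclidean]
    intro k
    simp only [hL]
    split_ifs <;> fun_prop
  have hm : ∀ (x : EuclideanSpace ℝ (Fin (m + 3))) (k : ℕ) (h : k < m + 3),
      x ⟨k, h⟩ = coordSeq x k := fun x k h => (coordSeq_of_lt x h).symm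
  simp only [Finset.prod_pow, prod_castLE_cosh] at hL ⊢
  simp only [hm, Nat.add_sub_cancel] at hL ⊢
  have key := eta_fderiv_eq hA hB hdiff
    (fun x => by rw [hL]; simp; ring)
    (fun x => by rw [hL]; simp; ring)
    (fun x => by rw [hL]; simp; ring)
    (fun x k => by rw [hL]; simp [show (k : ℕ) + 3 ≤ m + 2 by omega])
    (fun x => by rw [hL]; simp; ring)
    (fun x => by rw [hL]; simp; ring)
  intro x
  simp only [pd, key, coordSeq_single]
  refine ⟨fun i j hij => ?_, ?_, fun i hi hi' => ?_, ?_, ?_⟩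
  · have hz : ∀ k : ℕ, (if k = (i : ℕ) then (1 : ℝ) else 0) * (if k = (j : ℕ) then 1 else 0) = 0 := by
      intro k
      have := Fin.val_ne_of_ne hij
      split_ifs <;> first | omega | simp
    simp [hz]
  · have : 0 < m := by omega
    simp [coshProd, this, this.ne']
  · rcases hi'.lt_or_eq with h | h
    · have h0 : m ≠ i := by omega
      have h1 : m + 1 ≠ i := by omega
      have h2 : m + 2 ≠ i := by omega
      simp [h, h0, h1, h2]
    · simp [h]
  · simp [mul_pow]
  · simp [mul_pow]
end

section
/- Let n ≥ 4 be an integer and a, b real numbers with a² < b², let U = {x ∈ ℝⁿ : a sinh x_{n−2} + b cosh x_{n−2} > 0}, and let L : ℝⁿ → ℝ^{n+2} be immersion (B) (with S = sinh x_{n−2}, C = cosh x_{n−2}, P = ∏_{j=1}^{n−3} cosh x_j, ρ = x_{n−1}²+x_n²: u₁ = [a(b⁴−4+4b²ρ)S + b(b⁴+4+4b²ρ)C]P/(4b³); u₂ = [a(b⁴+4−4b²ρ)S + b(b⁴−4−4b²ρ)C]P/(4b³); u_{k+2} = sinh(x_k)∏_{j=1}^{k−1} cosh x_j for 1 ≤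 k ≤ n−3; u_n = (√(b²−a²)/b)SP; u_{n+1} = (aS+bC)x_{n−1}P; u_{n+2} = (aS+bC)x_nP). Then there exists a smooth map ξ : U → ℝ^{n+2} such that for every x ∈ U: η(ξ(x), ξ(x)) = 1; η(ξ(x), L(x)) = 0; η(ξ(x), ∂L/∂x_i(x)) = 0 for all 1 ≤ i ≤ n; η(∂²L/∂x_i∂x_j(x), ξ(x)) = 0 for every pair (i,j) other than (n−1,n−1) and (n,n); and η(∂²L/∂x_{n−1}²(x), ξ(x)) = η(∂²L/∂x_n²(x), ξ(x)) = √(b²−a²)(aS+bC)P. In particular the second fundamental form in direction ξ equals λ times the induced metric on the last two coordinate directions and vanishes otherwise, where λ = √(b²−a²)/((aS+bC)P) is nowhere zero, so the hypersurface has no minimal points in hyperbolic space. -/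
open Real

/-- Second partial derivative of `L` at `x` in the directions of the `i`-th and `j`-th
standard basis vectors. -/
noncomputable def pd2 {n : ℕ} {F : Type*} [NormedAddCommGroup F] [NormedSpace ℝ F]
    (L : EuclideanSpace ℝ (Fin n) → F) (x : EuclideanSpace ℝ (Fin n)) (i j : Fin n) : F :=
  pd (fun y => pd L y i) x j

/-- The Minkowski form with its first argument fixed, as a continuous linear functional. -/
noncomputable def etaCLM {N : ℕ} (u : EuclideanSpace ℝ (Fin (N + 1))) :
    EuclideanSpace ℝ (Fin (N + 1)) →L[ℝ] ℝ :=
  -(u 0 • EuclideanSpace.proj 0) + ∑ j : Fin N, u j.succ • EuclideanSpace.proj j.succ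

theorem etaCLM_apply {N : ℕ} (u v : EuclideanSpace ℝ (Fin (N + 1))) :
    etaCLM u v = eta u v := by
  simp [etaCLM, eta]

theorem eta_comm {N : ℕ} (u v : EuclideanSpace ℝ (Fin (N + 1))) : eta u v = eta v u := by
  simp [eta, mul_comm]

theorem eta_eq_of_middle_zero {m : ℕ} (v u : EuclideanSpace ℝ (Fin (m + 3 + 2)))
    (hv : ∀ k : Fin (m + 3 + 2), 2 ≤ (k : ℕ) → (k : ℕ) ≤ m + 1 → v k = 0) :
    eta v u = -(v ⟨0, by omega⟩ * u ⟨0, by omega⟩) + v ⟨1, by omega⟩ * u ⟨1, by omega⟩ +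
      v ⟨m + 2, by omega⟩ * u ⟨m + 2, by omega⟩ +
      v ⟨m + 3, by omega⟩ * u ⟨m + 3, by omega⟩ +
      v ⟨m + 4, by omega⟩ * u ⟨m + 4, by omega⟩ := by
  unfold eta
  rw [Fin.sum_univ_succ, Fin.sum_univ_castSucc, Fin.sum_univ_castSucc, Fin.sum_univ_castSucc,
    Finset.sum_eq_zero]
  · simp only [zero_add, add_assoc]
    rfl
  · intro j _
    rw [hv _ (by simp) (by simp), zero_mul]

theorem ContDiff.pd {n : ℕ} {F : Type*} [NormedAddCommGroup F] [NormedSpace ℝ F]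
    {L : EuclideanSpace ℝ (Fin n) → F} (hL : ContDiff ℝ 2 L) (i : Fin n) :
    ContDiff ℝ 1 (fun y => pd L y i) :=
  (hL.fderiv_right (m := 1) (by norm_num)).clm_apply contDiff_const

theorem clm_pd {n : ℕ} {F : Type*} [NormedAddCommGroup F] [NormedSpace ℝ F]
    {L : EuclideanSpace ℝ (Fin n) → F} (φ : F →L[ℝ] ℝ) (hL : ContDiff ℝ 1 L)
    (x : EuclideanSpace ℝ (Fin n)) (i : Fin n) :
    φ (pd L x i) = pd (fun y => φ (L y)) x i := by
  have h : HasFDerivAt (fun y => φ (L y)) (φ.comp (fderiv ℝ L x)) x :=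
    φ.hasFDerivAt.comp x (hL.differentiable (by norm_num) x).hasFDerivAt
  simp [_root_.pd, h.fderiv]

theorem clm_pd2 {n : ℕ} {F : Type*} [NormedAddCommGroup F] [NormedSpace ℝ F]
    {L : EuclideanSpace ℝ (Fin n) → F} (φ : F →L[ℝ] ℝ) (hL : ContDiff ℝ 2 L)
    (x : EuclideanSpace ℝ (Fin n)) (i j : Fin n) :
    φ (pd2 L x i j) = pd2 (fun y => φ (L y)) x i j := by
  unfold pd2
  rw [clm_pd φ (hL.pd i)]
  simp only [clm_pd φ (hL.of_le (by norm_num))]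

theorem pd_mul {n : ℕ} {f g : EuclideanSpace ℝ (Fin n) → ℝ} {x : EuclideanSpace ℝ (Fin n)}
    (hf : DifferentiableAt ℝ f x) (hg : DifferentiableAt ℝ g x) (i : Fin n) :
    pd (fun y => f y * g y) x i = f x * pd g x i + g x * pd f x i := by
  simp [pd, fderiv_fun_mul hf hg]

theorem pd_add {n : ℕ} {f g : EuclideanSpace ℝ (Fin n) → ℝ} {x : EuclideanSpace ℝ (Fin n)}
    (hf : DifferentiableAt ℝ f x) (hg : DifferentiableAt ℝ g x) (i : Fin n) :
    pd (fun y => f y + g y) x i = pd f x i + pd g x i := by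
  simp [pd, fderiv_fun_add hf hg]

theorem pd_coord_sub_const {n : ℕ} (p : Fin n) (c : ℝ) (x : EuclideanSpace ℝ (Fin n))
    (i : Fin n) : pd (fun y : EuclideanSpace ℝ (Fin n) => y p - c) x i = if p = i then 1 else 0 := by
  have h : HasFDerivAt (fun y : EuclideanSpace ℝ (Fin n) => y p - c)
      (EuclideanSpace.proj p : EuclideanSpace ℝ (Fin n) →L[ℝ] ℝ) x :=
    (EuclideanSpace.proj p : EuclideanSpace ℝ (Fin n) →L[ℝ] ℝ).hasFDerivAt.sub_const c
  simp [pd, h.fderiv]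

theorem pd_mul_sq_dist {n : ℕ} {W : EuclideanSpace ℝ (Fin n) → ℝ} (hW : ContDiff ℝ 2 W)
    (p q : Fin n) (c d : ℝ) (x : EuclideanSpace ℝ (Fin n)) (i : Fin n) :
    pd (fun y => W y * ((y p - c) * (y p - c) + (y q - d) * (y q - d))) x i =
      W x * (2 * (if p = i then 1 else 0) * (x p - c) + 2 * (if q = i then 1 else 0) * (x q - d)) +
        ((x p - c) * (x p - c) + (x q - d) * (x q - d)) * pd W x i := by
  have hWd := hW.differentiable (by norm_num) x
  rw [pd_mul hWd (by fun_prop), pd_add (by fun_prop) (by fun_prop),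
    pd_mul (by fun_prop) (by fun_prop), pd_mul (by fun_prop) (by fun_prop),
    pd_coord_sub_const, pd_coord_sub_const]
  ring

theorem pd2_mul_sq_dist {n : ℕ} {W : EuclideanSpace ℝ (Fin n) → ℝ} (hW : ContDiff ℝ 2 W)
    (p q : Fin n) (x : EuclideanSpace ℝ (Fin n)) (i j : Fin n) :
    pd2 (fun y => W y * ((y p - x p) * (y p - x p) + (y q - x q) * (y q - x q))) x i j =
      2 * W x * ((if p = i then 1 else 0) * (if p = j then 1 else 0) +
        (if q = i then 1 else 0) * (if q = j then 1 else 0)) := by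
  have hWd := hW.differentiable (by norm_num) x
  have hWi := (hW.pd i).differentiable (by norm_num) x
  have hc : ∀ (e : ℝ) (r : Fin n),
      pd (fun y : EuclideanSpace ℝ (Fin n) => e * (y r - x r)) x j =
        e * if r = j then 1 else 0 := by
    intro e r
    rw [pd_mul (by fun_prop) (by fun_prop), pd_coord_sub_const]
    simp [pd]
  unfold pd2
  simp only [pd_mul_sq_dist hW]
  rw [pd_add (by fun_prop) (by fun_prop), pd_mul hWd (by fun_prop),
    pd_mul (by fun_prop) hWi, pd_add (by fun_prop) (by fun_prop),
    pd_add (by fun_prop) (by fun_prop), hc, hc,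
    pd_mul (by fun_prop) (by fun_prop), pd_mul (by fun_prop) (by fun_prop)]
  simp only [sub_self]
  ring

/-- A unit normal along the immersion; it depends only on the last two coordinates. -/
noncomputable def unitNormal (a b : ℝ) (n : ℕ) (s t : ℝ) : EuclideanSpace ℝ (Fin (n + 2)) :=
  WithLp.toLp 2 fun k =>
    let d := √(b ^ 2 - a ^ 2)
    let r := 2 * d * (s ^ 2 + t ^ 2 - 1 / b ^ 2) / b
    if (k : ℕ) = 0 then -(b * d / 2 + r) / 2
    else if (k : ℕ) = 1 then (r - b * d / 2) / 2
    else if (k : ℕ) ≤ n - 2 then 0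
    else if (k : ℕ) = n - 1 then a / b
    else if (k : ℕ) = n then -(s * d)
    else -(t * d)

theorem eta_unitNormal (a b : ℝ) (m : ℕ) (s t : ℝ)
    (u : EuclideanSpace ℝ (Fin (m + 3 + 2))) :
    eta (unitNormal a b (m + 3) s t) u =
      (b * √(b ^ 2 - a ^ 2) / 2 + 2 * √(b ^ 2 - a ^ 2) * (s ^ 2 + t ^ 2 - 1 / b ^ 2) / b) / 2 *
        u ⟨0, by omega⟩ +
      (2 * √(b ^ 2 - a ^ 2) * (s ^ 2 + t ^ 2 - 1 / b ^ 2) / b - b * √(b ^ 2 - a ^ 2) / 2) / 2 *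
        u ⟨1, by omega⟩ +
      a / b * u ⟨m + 2, by omega⟩ - s * √(b ^ 2 - a ^ 2) * u ⟨m + 3, by omega⟩ -
      t * √(b ^ 2 - a ^ 2) * u ⟨m + 4, by omega⟩ := by
  rw [eta_eq_of_middle_zero]
  · simp [unitNormal]
    ring
  · intro k h2 hk
    simp [unitNormal, show k ≠ 0 by rintro rfl; simp at h2, show (k : ℕ) ≠ 1 by omega, hk]

theorem eta_unitNormal_self {a b : ℝ} (hab : a ^ 2 < b ^ 2) (m : ℕ) (s t : ℝ) :
    eta (unitNormal a b (m + 3) s t) (unitNormal a b (m + 3) s t) = 1 := by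
  have hb : b ≠ 0 := by rintro rfl; nlinarith [sq_nonneg a]
  have hd : √(b ^ 2 - a ^ 2) ^ 2 = b ^ 2 - a ^ 2 := Real.sq_sqrt (by linarith)
  rw [eta_unitNormal]
  simp [unitNormal]
  generalize √(b ^ 2 - a ^ 2) = d at *
  have ha : a ^ 2 = b ^ 2 - d ^ 2 := by linarith
  field_simp
  ring_nf
  simp only [ha]
  ring

theorem contDiff_unitNormal (a b : ℝ) (n : ℕ) (p q : Fin n) :
    ContDiff ℝ (⊤ : ℕ∞) fun x : EuclideanSpace ℝ (Fin n) => unitNormal a b n (x p) (x q) := by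
  rw [contDiff_euclidean]
  intro k
  simp only [unitNormal]
  split_ifs <;> fun_prop

theorem stmt15 (n : ℕ) (hn : 4 ≤ n) (a b : ℝ) (hab : a ^ 2 < b ^ 2)
    (U : Set (EuclideanSpace ℝ (Fin n)))
    (hU : U = {x | 0 < a * Real.sinh (x ⟨n - 3, by omega⟩) +
      b * Real.cosh (x ⟨n - 3, by omega⟩)})
    (L : EuclideanSpace ℝ (Fin n) → EuclideanSpace ℝ (Fin (n + 2)))
    (hL : ∀ (x : EuclideanSpace ℝ (Fin n)) (k : Fin (n + 2)),
      L x k =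
        (let S := Real.sinh (x ⟨n - 3, by omega⟩);
         let C := Real.cosh (x ⟨n - 3, by omega⟩);
         let P := ∏ j : Fin (n - 3), Real.cosh (x (Fin.castLE (by omega) j));
         let ρ := x ⟨n - 2, by omega⟩ ^ 2 + x ⟨n - 1, by omega⟩ ^ 2;
         if (k : ℕ) = 0 then
           (a * (b ^ 4 - 4 + 4 * b ^ 2 * ρ) * S + b * (b ^ 4 + 4 + 4 * b ^ 2 * ρ) * C) *
             P / (4 * b ^ 3)
         else if (k : ℕ) = 1 then
           (a * (b ^ 4 + 4 - 4 * b ^ 2 * ρ) * S + b * (b ^ 4 - 4 - 4 * b ^ 2 * ρ) * C) *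
             P / (4 * b ^ 3)
         else if h : (k : ℕ) ≤ n - 2 then
           Real.sinh (x ⟨(k : ℕ) - 2, by omega⟩) *
             ∏ j : Fin ((k : ℕ) - 2), Real.cosh (x (Fin.castLE (by omega) j))
         else if (k : ℕ) = n - 1 then
           Real.sqrt (b ^ 2 - a ^ 2) / b * S * P
         else if (k : ℕ) = n then
           (a * S + b * C) * x ⟨n - 2, by omega⟩ * P
         else
           (a * S + b * C) * x ⟨n - 1, by omega⟩ * P)) :
    ∃ ξ : EuclideanSpace ℝ (Fin n) → EuclideanSpace ℝ (Fin (n + 2)),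
      ContDiffOn ℝ (⊤ : ℕ∞) ξ U ∧
      ∀ x ∈ U,
        eta (ξ x) (ξ x) = 1 ∧
        eta (ξ x) (L x) = 0 ∧
        (∀ i : Fin n, eta (ξ x) (pd L x i) = 0) ∧
        (∀ i j : Fin n, ¬(i = j ∧ ((i : ℕ) = n - 2 ∨ (i : ℕ) = n - 1)) →
          eta (pd2 L x i j) (ξ x) = 0) ∧
        eta (pd2 L x ⟨n - 2, by omega⟩ ⟨n - 2, by omega⟩) (ξ x) =
          Real.sqrt (b ^ 2 - a ^ 2) *
            (a * Real.sinh (x ⟨n - 3, by omega⟩) + b * Real.cosh (x ⟨n - 3, by omega⟩)) *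
            (∏ j : Fin (n - 3), Real.cosh (x (Fin.castLE (by omega) j))) ∧
        eta (pd2 L x ⟨n - 1, by omega⟩ ⟨n - 1, by omega⟩) (ξ x) =
          Real.sqrt (b ^ 2 - a ^ 2) *
            (a * Real.sinh (x ⟨n - 3, by omega⟩) + b * Real.cosh (x ⟨n - 3, by omega⟩)) *
            (∏ j : Fin (n - 3), Real.cosh (x (Fin.castLE (by omega) j))) ∧
        Real.sqrt (b ^ 2 - a ^ 2) /
            ((a * Real.sinh (x ⟨n - 3, by omega⟩) + b * Real.cosh (x ⟨n - 3, by omega⟩)) *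
              ∏ j : Fin (n - 3), Real.cosh (x (Fin.castLE (by omega) j))) ≠ 0 := by
  obtain ⟨m, rfl⟩ : ∃ m, n = m + 3 := ⟨n - 3, by omega⟩
  have hb : b ≠ 0 := by rintro rfl; nlinarith [sq_nonneg a]
  have hd : 0 < √(b ^ 2 - a ^ 2) := Real.sqrt_pos.2 (by linarith)
  have hLsmooth : ContDiff ℝ 2 L := by
    rw [contDiff_euclidean]
    intro k
    simp only [hL]
    split_ifs <;> fun_prop
  let p : Fin (m + 3) := ⟨m + 3 - 2, by omega⟩
  let q : Fin (m + 3) := ⟨m + 3 - 1, by omega⟩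
  let w : EuclideanSpace ℝ (Fin (m + 3)) → ℝ := fun y =>
    √(b ^ 2 - a ^ 2) * (a * Real.sinh (y ⟨m + 3 - 3, by omega⟩) +
      b * Real.cosh (y ⟨m + 3 - 3, by omega⟩)) *
      ∏ j : Fin (m + 3 - 3), Real.cosh (y (Fin.castLE (by omega) j))
  have hw : ContDiff ℝ 2 fun y => 1 / 2 * w y := by
    simp only [w]
    fun_prop
  have key : ∀ x y : EuclideanSpace ℝ (Fin (m + 3)),
      eta (unitNormal a b (m + 3) (x p) (x q)) (L y) =
        1 / 2 * w y * ((y p - x p) * (y p - x p) + (y q - x q) * (y q - x q)) := by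
    intro x y
    rw [eta_unitNormal]
    simp [hL, w, p, q]
    generalize √(b ^ 2 - a ^ 2) = d at *
    field_simp
    ring
  have keyfun : ∀ x : EuclideanSpace ℝ (Fin (m + 3)),
      (fun y => etaCLM (unitNormal a b (m + 3) (x p) (x q)) (L y)) = fun y =>
      1 / 2 * w y * ((y p - x p) * (y p - x p) + (y q - x q) * (y q - x q)) := by
    intro x
    funext y
    rw [etaCLM_apply, key]
  have second : ∀ (x : EuclideanSpace ℝ (Fin (m + 3))) (i j : Fin (m + 3)),
      eta (pd2 L x i j) (unitNormal a b (m + 3) (x p) (x q)) =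
      w x * ((if p = i then 1 else 0) * (if p = j then 1 else 0) +
        (if q = i then 1 else 0) * (if q = j then 1 else 0)) := by
    intro x i j
    rw [eta_comm, ← etaCLM_apply, clm_pd2 _ hLsmooth, keyfun, pd2_mul_sq_dist hw]
    ring
  have hpq : p ≠ q := by simp [p, q, Fin.ext_iff]
  refine ⟨fun x => unitNormal a b (m + 3) (x p) (x q),
    (contDiff_unitNormal a b _ p q).contDiffOn, fun x hx => ⟨eta_unitNormal_self hab _ _ _, ?_,
      fun i => ?_, fun i j hij => ?_, ?_, ?_, ?_⟩⟩
  · simp [key]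
  · rw [← etaCLM_apply, clm_pd _ (hLsmooth.of_le (by norm_num)), keyfun, pd_mul_sq_dist hw]
    simp
  · rw [second]
    have h1 : ¬(p = i ∧ p = j) := by
      rintro ⟨rfl, rfl⟩
      exact hij ⟨rfl, Or.inl rfl⟩
    have h2 : ¬(q = i ∧ q = j) := by
      rintro ⟨rfl, rfl⟩
      exact hij ⟨rfl, Or.inr rfl⟩
    simp only [← ite_and, mul_ite, mul_one, mul_zero]
    rw [if_neg (by tauto), if_neg (by tauto)]
    simp
  · refine (second x p p).trans ?_
    simp [hpq.symm, w]
  · refine (second x q q).trans ?_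
    simp [hpq, w]
  · rw [hU] at hx
    exact (div_pos hd (mul_pos hx (Finset.prod_pos fun _ _ => Real.cosh_pos _))).ne'
end
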